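/- Let n ≥ 2 and fix x ∈ ℝ^{n+1}\{0} and indices i, j ∈ {1, …, n+1}. Then the limit lim_{R→∞} ∫_{B_R(0)} F_{x_j}(x,y) · ∂_{y_i}( |y|^{−1} ) dy exists and equals (1/n) ( δ_{ij}/|x| − x_i x_j / |x|³ ), where F_{x_j}(x,y) = (x_j − y_j) / ( ω_n |x − y|^{n+1} ) is the x_j-partial derivative of the fundamental solution F(x,y) = (1/((1−n)ω_n)) |x−y|^{1−n} of the Laplace equation in ℝ^{n+1}, and ∂_{y_i}(|y|^{−1}) = −y_i/|y|³. -/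

import Mathlib

open MeasureTheory Metric Set Filter

/-- `ω_n`, the total surface measure of the unit sphere `Sⁿ ⊂ ℝ^{n+1}`. -/
noncomputable def omega_n (n : ℕ) : ℝ :=
  ((volume : Measure (EuclideanSpace ℝ (Fin (n + 1)))).toSphere Set.univ).toReal


theorem hasLineDerivAt_apply {ι : Type*} [DecidableEq ι] (z : EuclideanSpace ℝ ι) (i k : ι) :
    HasLineDerivAt ℝ (fun z : EuclideanSpace ℝ ι => z i) (if i = k then 1 else 0) z
      (EuclideanSpace.single k 1) := by
  have h := ((hasDerivAt_id (0 : ℝ)).mul_const (if i = k then (1 : ℝ) else 0)).const_add (z i)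
  simpa [HasLineDerivAt, Pi.single_apply] using h

section RegularizedNorm

variable {ι : Type*} [Fintype ι]

/-- The smooth regularization `√(‖z‖² + ε²)` of the Euclidean norm. -/
noncomputable def regNorm (ε : ℝ) (z : EuclideanSpace ℝ ι) : ℝ := √(‖z‖ ^ 2 + ε ^ 2)

theorem sq_regNorm (ε : ℝ) (z : EuclideanSpace ℝ ι) : regNorm ε z ^ 2 = ‖z‖ ^ 2 + ε ^ 2 :=
  Real.sq_sqrt (by positivity)

theorem regNorm_pos {ε : ℝ} (hε : 0 < ε) (z : EuclideanSpace ℝ ι) : 0 < regNorm ε z :=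
  Real.sqrt_pos.2 (by positivity)

theorem norm_le_regNorm (ε : ℝ) (z : EuclideanSpace ℝ ι) : ‖z‖ ≤ regNorm ε z :=
  Real.le_sqrt_of_sq_le (by nlinarith [sq_nonneg ε])

theorem le_regNorm (ε : ℝ) (z : EuclideanSpace ℝ ι) : ε ≤ regNorm ε z :=
  Real.le_sqrt_of_sq_le (by nlinarith [sq_nonneg ‖z‖])

theorem abs_apply_le_regNorm (ε : ℝ) (z : EuclideanSpace ℝ ι) (i : ι) : |z i| ≤ regNorm ε z :=
  (PiLp.norm_apply_le z i).trans (norm_le_regNorm ε z)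

theorem regNorm_mono {ε M : ℝ} (hε : 0 ≤ ε) (h : ε ≤ M) (z : EuclideanSpace ℝ ι) :
    regNorm ε z ≤ regNorm M z :=
  Real.sqrt_le_sqrt (by gcongr)

theorem regNorm_zero (z : EuclideanSpace ℝ ι) : regNorm 0 z = ‖z‖ := by
  simp [regNorm, Real.sqrt_sq]

theorem regNorm_smul {ε : ℝ} (hε : 0 ≤ ε) (z : EuclideanSpace ℝ ι) :
    regNorm ε (ε • z) = ε * regNorm 1 z := by
  rw [regNorm, regNorm, norm_smul, Real.norm_eq_abs, mul_pow, sq_abs,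
    show ε ^ 2 * ‖z‖ ^ 2 + ε ^ 2 = ε ^ 2 * (‖z‖ ^ 2 + 1 ^ 2) by ring,
    Real.sqrt_mul (sq_nonneg ε), Real.sqrt_sq hε]

@[fun_prop]
theorem continuous_regNorm (ε : ℝ) : Continuous (regNorm ε : EuclideanSpace ℝ ι → ℝ) := by
  unfold regNorm
  fun_prop

theorem continuous_regNorm_left (z : EuclideanSpace ℝ ι) : Continuous fun ε => regNorm ε z := by
  unfold regNorm
  fun_prop

variable [DecidableEq ι]

theorem hasLineDerivAt_regNorm {ε : ℝ} (hε : 0 < ε) (z : EuclideanSpace ℝ ι) (k : ι) :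
    HasLineDerivAt ℝ (regNorm ε) (z k / regNorm ε z) z (EuclideanSpace.single k 1) := by
  have h1 : ∀ t : ℝ, ‖z + t • EuclideanSpace.single k (1 : ℝ)‖ ^ 2
      = ‖z‖ ^ 2 + 2 * z k * t + t ^ 2 := fun t => by
    rw [norm_add_sq_real, inner_smul_right, EuclideanSpace.inner_single_right, norm_smul]
    simp
    ring
  have h2 : HasDerivAt (fun t : ℝ => ‖z‖ ^ 2 + 2 * z k * t + t ^ 2 + ε ^ 2) (2 * z k) 0 := by
    have := ((((hasDerivAt_id (0 : ℝ)).const_mul (2 * z k)).const_add (‖z‖ ^ 2)).add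
      ((hasDerivAt_id (0 : ℝ)).pow 2)).add_const (ε ^ 2)
    simpa using! this
  have h3 := h2.sqrt (by simp only [mul_zero, add_zero]; positivity)
  unfold HasLineDerivAt regNorm
  simp only [h1]
  refine h3.congr_deriv ?_
  simp [mul_div_mul_left]

theorem hasLineDerivAt_one_div_regNorm_pow {ε : ℝ} (hε : 0 < ε) (z : EuclideanSpace ℝ ι)
    (k : ι) (m : ℕ) :
    HasLineDerivAt ℝ (fun z => 1 / regNorm ε z ^ m) (-(m * z k / regNorm ε z ^ (m + 2))) z
      (EuclideanSpace.single k 1) := by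
  have h := hasLineDerivAt_regNorm hε z k
  have h0 := regNorm_pos hε z
  unfold HasLineDerivAt at h ⊢
  have h2 := (h.pow m).fun_inv (by simpa using (pow_pos h0 m).ne')
  simp only [one_div]
  refine h2.congr_deriv ?_
  rcases m with _ | m
  · simp
  · simp only [Pi.pow_apply, zero_smul, add_zero, Nat.add_sub_cancel]
    field_simp
    ring

theorem hasLineDerivAt_apply_div_regNorm_pow {ε : ℝ} (hε : 0 < ε) (z : EuclideanSpace ℝ ι)
    (i k : ι) (m : ℕ) :
    HasLineDerivAt ℝ (fun z => z i / regNorm ε z ^ m)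
      ((if i = k then 1 else 0) / regNorm ε z ^ m - m * z i * z k / regNorm ε z ^ (m + 2)) z
      (EuclideanSpace.single k 1) := by
  have h1 := hasLineDerivAt_apply z i k
  have h2 := hasLineDerivAt_one_div_regNorm_pow hε z k m
  unfold HasLineDerivAt at h1 h2 ⊢
  refine ((h1.mul h2).congr_deriv ?_).congr_of_eventuallyEq (.of_forall fun t => ?_)
  · simp only [zero_smul, add_zero]
    ring
  · exact div_eq_mul_one_div _ _

end RegularizedNorm

section IntegrationByParts

variable {ι : Type*} [Fintype ι] [DecidableEq ι]

theorem HasLineDerivAt.comp_const_sub {E : Type*} [NormedAddCommGroup E] [NormedSpace ℝ E]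
    {f : E → ℝ} {f' : ℝ} {x y v : E} (h : HasLineDerivAt ℝ f f' (x - y) v) :
    HasLineDerivAt ℝ (fun y => f (x - y)) (-f') y v := by
  unfold HasLineDerivAt at h ⊢
  have h' : HasDerivAt (fun t : ℝ => f (x - y + t • v)) f' (-0) := by simpa using h
  have h2 := h'.scomp (0 : ℝ) (hasDerivAt_neg (0 : ℝ))
  refine (h2.congr_deriv (by simp)).congr_of_eventuallyEq (.of_forall fun t => ?_)
  simp only [Function.comp_apply]
  congr 1
  module

/-- For curl-free fields `A` and `w`, the divergence can be moved from one factor of a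
convolution to the other. -/
theorem integral_mul_divergence_eq {A w : ι → EuclideanSpace ℝ ι → ℝ}
    {A' w' : ι → ι → EuclideanSpace ℝ ι → ℝ}
    (hA : ∀ j k z, HasLineDerivAt ℝ (A j) (A' j k z) z (EuclideanSpace.single k 1))
    (hw : ∀ j k z, HasLineDerivAt ℝ (w j) (w' j k z) z (EuclideanSpace.single k 1))
    (hA_symm : ∀ j k z, A' j k z = A' k j z) (hw_symm : ∀ j k z, w' j k z = w' k j z)
    (hA_int : ∀ j, Integrable (A j)) (hA'_int : ∀ j k, Integrable (A' j k))
    (hw_cont : ∀ j, Continuous (w j)) (hw'_cont : ∀ j k, Continuous (w' j k))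
    (hw_bdd : ∀ j, ∃ C, ∀ y, |w j y| ≤ C) (hw'_bdd : ∀ j k, ∃ C, ∀ y, |w' j k y| ≤ C)
    (x : EuclideanSpace ℝ ι) (j : ι) :
    ∫ y, A j (x - y) * ∑ k, w' k k y = ∫ y, (∑ k, A' k k (x - y)) * w j y := by
  have key : ∀ {f g : EuclideanSpace ℝ ι → ℝ}, Integrable f → Continuous g →
      (∃ C, ∀ y, |g y| ≤ C) → Integrable fun y => f (x - y) * g y := by
    rintro f g hf hg ⟨C, hC⟩
    exact (hf.comp_sub_left x).mul_bdd (c := C) hg.aestronglyMeasurable (.of_forall hC)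
  have parts : ∀ j k l, ∫ y, A j (x - y) * w' l k y = ∫ y, A' j k (x - y) * w l y := by
    intro j k l
    have h := integral_bilinear_hasLineDerivAt_right_eq_neg_left_of_integrable
      (μ := (volume : Measure (EuclideanSpace ℝ ι)))
      (f := fun y => A j (x - y)) (f' := fun y => -A' j k (x - y)) (g := w l) (g' := w' l k)
      (v := EuclideanSpace.single k 1) (B := ContinuousLinearMap.mul ℝ ℝ)
      (by simpa using (key (hA'_int j k) (hw_cont l) (hw_bdd l)).neg)
      (key (hA_int j) (hw'_cont l k) (hw'_bdd l k)) (key (hA_int j) (hw_cont l) (hw_bdd l))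
      (fun y _ => (hA j k (x - y)).comp_const_sub) (fun y _ => hw l k y)
    simpa [integral_neg] using h
  simp only [Finset.mul_sum, Finset.sum_mul]
  rw [integral_finsetSum _ fun k _ => key (hA_int j) (hw'_cont k k) (hw'_bdd k k),
    integral_finsetSum _ fun k _ => key (hA'_int k k) (hw_cont j) (hw_bdd j)]
  refine Finset.sum_congr rfl fun k _ => ?_
  calc ∫ y, A j (x - y) * w' k k y = ∫ y, A' j k (x - y) * w k y := parts j k k
    _ = ∫ y, A' k j (x - y) * w k y := by simp only [hA_symm j k]
    _ = ∫ y, A k (x - y) * w' k j y := (parts k j k).symm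
    _ = ∫ y, A k (x - y) * w' j k y := by simp only [hw_symm k j]
    _ = ∫ y, A' k k (x - y) * w j y := parts k k j

end IntegrationByParts

section RadialFields

variable {ι : Type*} [Fintype ι]

theorem abs_apply_mul_apply_le (ε : ℝ) (z : EuclideanSpace ℝ ι) (j k : ι) :
    |z j * z k| ≤ regNorm ε z ^ 2 := by
  rw [abs_mul, sq]
  have := (abs_nonneg _).trans (abs_apply_le_regNorm ε z j)
  exact mul_le_mul (abs_apply_le_regNorm ε z j) (abs_apply_le_regNorm ε z k) (abs_nonneg _) this

theorem one_div_regNorm_pow_sub_nonneg {ε M : ℝ} (hε : 0 < ε) (hM : ε ≤ M) (m : ℕ)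
    (z : EuclideanSpace ℝ ι) : 0 ≤ 1 / regNorm ε z ^ m - 1 / regNorm M z ^ m := by
  have h0 := regNorm_pos hε z
  have h1 := regNorm_mono hε.le hM z
  rw [sub_nonneg]
  gcongr

theorem one_div_regNorm_pow_sub_le {ε M : ℝ} (hε : 0 < ε) (hM : ε ≤ M) (m : ℕ)
    (z : EuclideanSpace ℝ ι) :
    1 / regNorm ε z ^ m - 1 / regNorm M z ^ m ≤ m * M ^ 2 / regNorm ε z ^ (m + 2) := by
  have ha := regNorm_pos hε z
  have hb := regNorm_pos (hε.trans_le hM) z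
  have hab := regNorm_mono hε.le hM z
  have ha2 := sq_regNorm ε z
  have hb2 := sq_regNorm M z
  generalize regNorm ε z = a at *
  generalize regNorm M z = b at *
  set t := a / b with ht
  have ht0 : 0 < t := div_pos ha hb
  have ht1 : t ≤ 1 := (div_le_one hb).2 hab
  have hbern : 1 + m * (t - 1) ≤ t ^ m := by
    simpa using one_add_mul_le_pow (show -2 ≤ t - 1 by linarith) m
  have hsq : 1 - t ≤ M ^ 2 / a ^ 2 := by
    calc 1 - t ≤ 1 - t ^ 2 := by nlinarith
      _ = (b ^ 2 - a ^ 2) / b ^ 2 := by rw [ht]; field_simp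
      _ ≤ M ^ 2 / a ^ 2 := by
        gcongr
        nlinarith [sq_nonneg ε]
  calc 1 / a ^ m - 1 / b ^ m = 1 / a ^ m * (1 - t ^ m) := by rw [ht, div_pow]; field_simp
    _ ≤ 1 / a ^ m * (m * (M ^ 2 / a ^ 2)) := by
      gcongr
      nlinarith [(Nat.cast_nonneg m : (0 : ℝ) ≤ m)]
    _ = m * M ^ 2 / a ^ (m + 2) := by rw [pow_add]; field_simp

theorem integrable_one_div_regNorm_pow {ε : ℝ} (hε : 0 < ε) {m : ℕ} (hm : Fintype.card ι < m) :
    Integrable fun z : EuclideanSpace ℝ ι => 1 / regNorm ε z ^ m := by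
  have h := (integrable_one_add_norm (E := EuclideanSpace ℝ ι) (μ := volume) (r := m)
    (by simpa using hm)).const_mul ((1 / ε + 1) ^ m)
  refine h.mono' (Continuous.aestronglyMeasurable ?_) (.of_forall fun z => ?_)
  · exact continuous_const.div (by fun_prop) fun z => (pow_pos (regNorm_pos hε z) m).ne'
  · have h0 := regNorm_pos hε z
    rw [Real.norm_of_nonneg (by positivity), Real.rpow_neg (by positivity), Real.rpow_natCast,
      ← div_eq_mul_inv, div_le_div_iff₀ (by positivity) (by positivity), one_mul, ← mul_pow]
    gcongr
    have h1 : 1 ≤ 1 / ε * regNorm ε z := by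
      rw [one_div, ← div_eq_inv_mul, one_le_div hε]
      exact le_regNorm ε z
    linarith [norm_le_regNorm ε z]

theorem continuous_div_regNorm_pow {δ : ℝ} (hδ : 0 < δ)
    {f : EuclideanSpace ℝ ι → ℝ} (hf : Continuous f) (m : ℕ) :
    Continuous fun z => f z / regNorm δ z ^ m :=
  hf.div (by fun_prop) fun z => (pow_pos (regNorm_pos hδ z) m).ne'

theorem integrable_apply_div_regNorm_pow_sub {ε M : ℝ} (hε : 0 < ε) (hM : ε ≤ M) {m : ℕ}
    (hm : Fintype.card ι ≤ m) (j : ι) :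
    Integrable fun z : EuclideanSpace ℝ ι => z j / regNorm ε z ^ m - z j / regNorm M z ^ m := by
  have h := (integrable_one_div_regNorm_pow (ι := ι) hε (m := m + 1) (by omega)).const_mul
    (m * M ^ 2)
  refine h.mono' (Continuous.aestronglyMeasurable ?_) (.of_forall fun z => ?_)
  · exact (continuous_div_regNorm_pow hε (by fun_prop) m).sub
      (continuous_div_regNorm_pow (hε.trans_le hM) (by fun_prop) m)
  · have h0 := regNorm_pos hε z
    rw [show z j / regNorm ε z ^ m - z j / regNorm M z ^ m
      = z j * (1 / regNorm ε z ^ m - 1 / regNorm M z ^ m) by ring, norm_mul, Real.norm_eq_abs,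
      Real.norm_of_nonneg (one_div_regNorm_pow_sub_nonneg hε hM m z)]
    calc _ ≤ regNorm ε z * (m * M ^ 2 / regNorm ε z ^ (m + 2)) :=
          mul_le_mul (abs_apply_le_regNorm ε z j) (one_div_regNorm_pow_sub_le hε hM m z)
            (one_div_regNorm_pow_sub_nonneg hε hM m z) h0.le
      _ = _ := by
        field_simp
        ring

variable [DecidableEq ι]

/-- The Jacobian matrix of the vector field `z ↦ z / regNorm ε z ^ m`. -/
noncomputable def radialJacobian (m : ℕ) (ε : ℝ) (j k : ι) (z : EuclideanSpace ℝ ι) : ℝ :=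
  (if j = k then 1 else 0) / regNorm ε z ^ m - m * z j * z k / regNorm ε z ^ (m + 2)

theorem radialJacobian_symm (m : ℕ) (ε : ℝ) (j k : ι) (z : EuclideanSpace ℝ ι) :
    radialJacobian m ε j k z = radialJacobian m ε k j z := by
  simp only [radialJacobian, eq_comm (a := j)]
  ring

theorem continuous_radialJacobian (m : ℕ) {ε : ℝ} (hε : 0 < ε) (j k : ι) :
    Continuous (radialJacobian m ε j k) :=
  (continuous_div_regNorm_pow hε (by fun_prop) _).sub
    (continuous_div_regNorm_pow hε (by fun_prop) _)

theorem abs_radialJacobian_le (m : ℕ) {ε : ℝ} (hε : 0 < ε) (j k : ι) (z : EuclideanSpace ℝ ι) :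
    |radialJacobian m ε j k z| ≤ (m + 1) / regNorm ε z ^ m := by
  have h0 := regNorm_pos hε z
  have h1 : |(if j = k then (1 : ℝ) else 0) / regNorm ε z ^ m| ≤ 1 / regNorm ε z ^ m := by
    rw [abs_div, abs_of_pos (pow_pos h0 m)]
    gcongr
    split_ifs <;> simp
  have h2 : |m * z j * z k / regNorm ε z ^ (m + 2)| ≤ m / regNorm ε z ^ m := by
    rw [abs_div, abs_of_pos (pow_pos h0 _), mul_assoc, abs_mul, Nat.abs_cast,
      div_le_div_iff₀ (by positivity) (by positivity), pow_add]
    have := mul_le_mul_of_nonneg_left (abs_apply_mul_apply_le ε z j k)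
      (show 0 ≤ m * regNorm ε z ^ m by positivity)
    linarith
  calc _ ≤ 1 / regNorm ε z ^ m + m / regNorm ε z ^ m := (abs_sub _ _).trans (add_le_add h1 h2)
    _ = _ := by ring

theorem integrable_radialJacobian_sub {ε M : ℝ} (hε : 0 < ε) (hM : ε ≤ M) {m : ℕ}
    (hm : Fintype.card ι ≤ m) (j k : ι) :
    Integrable fun z => radialJacobian m ε j k z - radialJacobian m M j k z := by
  have h := (integrable_one_div_regNorm_pow (ι := ι) hε (m := m + 2) (by omega)).const_mul
    (m * M ^ 2 + m * ((m + 2 : ℕ) * M ^ 2))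
  refine h.mono' (Continuous.aestronglyMeasurable ?_) (.of_forall fun z => ?_)
  · exact (continuous_radialJacobian m hε j k).sub
      (continuous_radialJacobian m (hε.trans_le hM) j k)
  · have h0 := regNorm_pos hε z
    have hz := abs_apply_mul_apply_le ε z j k
    have n1 := one_div_regNorm_pow_sub_nonneg hε hM m z
    have n2 := one_div_regNorm_pow_sub_nonneg hε hM (m + 2) z
    have b1 := one_div_regNorm_pow_sub_le hε hM m z
    have b2 := one_div_regNorm_pow_sub_le hε hM (m + 2) z
    have e : radialJacobian m ε j k z - radialJacobian m M j k z
        = (if j = k then 1 else 0) * (1 / regNorm ε z ^ m - 1 / regNorm M z ^ m)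
          - m * (z j * z k * (1 / regNorm ε z ^ (m + 2) - 1 / regNorm M z ^ (m + 2))) := by
      simp only [radialJacobian]
      ring
    have h1 : |(if j = k then (1 : ℝ) else 0) * (1 / regNorm ε z ^ m - 1 / regNorm M z ^ m)|
        ≤ m * M ^ 2 / regNorm ε z ^ (m + 2) := by
      rw [abs_mul, abs_of_nonneg n1]
      refine (mul_le_of_le_one_left n1 ?_).trans b1
      split_ifs <;> simp
    have h2 : |m * (z j * z k * (1 / regNorm ε z ^ (m + 2) - 1 / regNorm M z ^ (m + 2)))|
        ≤ m * (regNorm ε z ^ 2 * ((m + 2 : ℕ) * M ^ 2 / regNorm ε z ^ (m + 2 + 2))) := by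
      rw [abs_mul, Nat.abs_cast, abs_mul, abs_of_nonneg n2]
      gcongr
    rw [e]
    calc _ ≤ _ := (abs_sub _ _).trans (add_le_add h1 h2)
      _ = _ := by
        field_simp
        ring

theorem sum_radialJacobian (m : ℕ) {ε : ℝ} (hε : 0 < ε) (z : EuclideanSpace ℝ ι)
    (hm : Fintype.card ι = m) :
    ∑ k, radialJacobian m ε k k z = m * ε ^ 2 / regNorm ε z ^ (m + 2) := by
  have h0 := regNorm_pos hε z
  have h2 := sq_regNorm ε z
  have hz := EuclideanSpace.real_norm_sq_eq z
  simp only [radialJacobian, if_true, Finset.sum_sub_distrib, ← Finset.sum_div, mul_assoc,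
    ← Finset.mul_sum, ← sq, ← hz, Finset.sum_const, Finset.card_univ, hm, nsmul_eq_mul]
  rw [pow_add]
  field_simp
  rw [h2]
  ring

/-- The matrix of derivatives of the `i`-th row of `radialJacobian 1 δ`, i.e. the third
derivatives of `regNorm δ`. -/
noncomputable def regNormThird (δ : ℝ) (i j k : ι) (y : EuclideanSpace ℝ ι) : ℝ :=
  3 * y i * y j * y k / regNorm δ y ^ 5
    - ((if i = j then 1 else 0) * y k + (if i = k then 1 else 0) * y j
      + (if j = k then 1 else 0) * y i) / regNorm δ y ^ 3

theorem regNormThird_symm (δ : ℝ) (i j k : ι) (y : EuclideanSpace ℝ ι) :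
    regNormThird δ i j k y = regNormThird δ i k j y := by
  simp only [regNormThird, eq_comm (a := j) (b := k)]
  ring

theorem continuous_regNormThird {δ : ℝ} (hδ : 0 < δ) (i j k : ι) :
    Continuous (regNormThird δ i j k) :=
  (continuous_div_regNorm_pow hδ (by fun_prop) 5).sub
    (continuous_div_regNorm_pow hδ (by fun_prop) 3)

theorem hasLineDerivAt_radialJacobian_one {δ : ℝ} (hδ : 0 < δ) (i j k : ι)
    (y : EuclideanSpace ℝ ι) :
    HasLineDerivAt ℝ (radialJacobian 1 δ i j) (regNormThird δ i j k y) y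
      (EuclideanSpace.single k 1) := by
  have h1 := hasLineDerivAt_one_div_regNorm_pow hδ y k 1
  have h2 := hasLineDerivAt_apply_div_regNorm_pow hδ y j k 3
  have h3 := hasLineDerivAt_apply y i k
  unfold HasLineDerivAt at *
  refine (((h1.const_mul (if i = j then (1 : ℝ) else 0)).sub (h3.mul h2)).congr_deriv
    ?_).congr_of_eventuallyEq (.of_forall fun t => ?_)
  · simp only [zero_smul, add_zero, regNormThird]
    push_cast
    ring
  · simp only [radialJacobian, Pi.sub_apply, Pi.mul_apply]
    push_cast
    ring

theorem abs_regNormThird_le {δ : ℝ} (hδ : 0 < δ) (i j k : ι) (y : EuclideanSpace ℝ ι) :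
    |regNormThird δ i j k y| ≤ 6 / regNorm δ y ^ 2 := by
  have h0 := regNorm_pos hδ y
  have hi := abs_apply_le_regNorm δ y i
  have hj := abs_apply_le_regNorm δ y j
  have hk := abs_apply_le_regNorm δ y k
  have hjk := abs_apply_mul_apply_le δ y j k
  have aux : ∀ (p : Prop) [Decidable p] (a : ℝ), |a| ≤ regNorm δ y →
      |(if p then 1 else 0) * a| ≤ regNorm δ y := by
    intro p _ a ha
    split_ifs <;> simp [ha, h0.le]
  have h1 : |3 * y i * y j * y k / regNorm δ y ^ 5| ≤ 3 / regNorm δ y ^ 2 := by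
    rw [abs_div, abs_of_pos (pow_pos h0 5), mul_assoc, mul_assoc, abs_mul, abs_mul,
      div_le_div_iff₀ (by positivity) (by positivity), abs_of_pos (three_pos : (0 : ℝ) < 3)]
    calc 3 * (|y i| * |y j * y k|) * regNorm δ y ^ 2
        ≤ 3 * (regNorm δ y * regNorm δ y ^ 2) * regNorm δ y ^ 2 := by gcongr
      _ = _ := by ring
  have h2 : |((if i = j then 1 else 0) * y k + (if i = k then 1 else 0) * y j
      + (if j = k then 1 else 0) * y i) / regNorm δ y ^ 3| ≤ 3 / regNorm δ y ^ 2 := by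
    rw [abs_div, abs_of_pos (pow_pos h0 3), div_le_div_iff₀ (by positivity) (by positivity)]
    calc _ ≤ (regNorm δ y + regNorm δ y + regNorm δ y) * regNorm δ y ^ 2 := by
          gcongr
          exact (abs_add_three _ _ _).trans
            (add_le_add (add_le_add (aux _ _ hk) (aux _ _ hj)) (aux _ _ hi))
      _ = _ := by ring
  calc _ ≤ 3 / regNorm δ y ^ 2 + 3 / regNorm δ y ^ 2 := (abs_sub _ _).trans (add_le_add h1 h2)
    _ = _ := by ring

theorem sum_regNormThird {δ : ℝ} (hδ : 0 < δ) (i : ι) (y : EuclideanSpace ℝ ι) :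
    ∑ k, regNormThird δ i k k y
      = -((Fintype.card ι - 1) * y i / regNorm δ y ^ 3) - 3 * δ ^ 2 * y i / regNorm δ y ^ 5 := by
  have h0 := regNorm_pos hδ y
  have h2 := sq_regNorm δ y
  have hy := EuclideanSpace.real_norm_sq_eq y
  simp only [regNormThird, if_true, Finset.sum_sub_distrib, ← Finset.sum_div, mul_assoc,
    ← Finset.mul_sum, ← sq, ← hy, Finset.sum_const, Finset.card_univ, nsmul_eq_mul,
    Finset.sum_add_distrib, ite_mul, one_mul, zero_mul, Finset.sum_ite_eq, Finset.mem_univ]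
  rw [show ‖y‖ ^ 2 = regNorm δ y ^ 2 - δ ^ 2 by rw [h2]; ring]
  field_simp
  ring

/-- Green's identity for the difference of two regularized fundamental solutions and a
derivative of `regNorm δ`. -/
theorem integral_regularized_green {ε M δ : ℝ} (hε : 0 < ε) (hM : ε ≤ M) (hδ : 0 < δ) {m : ℕ}
    (hm : Fintype.card ι = m) (x : EuclideanSpace ℝ ι) (i j : ι) :
    ∫ y, ((x j - y j) / regNorm ε (x - y) ^ m - (x j - y j) / regNorm M (x - y) ^ m)
        * ∑ k, regNormThird δ i k k y
      = ∫ y, (m * ε ^ 2 / regNorm ε (x - y) ^ (m + 2) - m * M ^ 2 / regNorm M (x - y) ^ (m + 2))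
        * radialJacobian 1 δ i j y := by
  have h := integral_mul_divergence_eq
    (A := fun j z => z j / regNorm ε z ^ m - z j / regNorm M z ^ m)
    (A' := fun j k z => radialJacobian m ε j k z - radialJacobian m M j k z)
    (w := radialJacobian 1 δ i) (w' := regNormThird δ i)
    (fun j k z => (hasLineDerivAt_apply_div_regNorm_pow hε z j k m).sub
      (hasLineDerivAt_apply_div_regNorm_pow (hε.trans_le hM) z j k m))
    (hasLineDerivAt_radialJacobian_one hδ i)
    (fun j k z => by rw [radialJacobian_symm, radialJacobian_symm m M])
    (regNormThird_symm δ i)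
    (integrable_apply_div_regNorm_pow_sub hε hM hm.le)
    (integrable_radialJacobian_sub hε hM hm.le)
    (continuous_radialJacobian 1 hδ i) (continuous_regNormThird hδ i)
    (fun j => ⟨2 / δ ^ 1, fun y => (abs_radialJacobian_le 1 hδ i j y).trans (by
      have := le_regNorm δ y
      norm_num
      gcongr)⟩)
    (fun j k => ⟨6 / δ ^ 2, fun y => (abs_regNormThird_le hδ i j k y).trans (by
      have := le_regNorm δ y
      gcongr)⟩) x j
  simpa only [Finset.sum_sub_distrib, sum_radialJacobian m hε _ hm,
    sum_radialJacobian m (hε.trans_le hM) _ hm, PiLp.sub_apply] using h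

end RadialFields

section Limits

variable {n : ℕ}

theorem omega_n_eq (n : ℕ) : omega_n n = (n + 1) *
    (volume : Measure (EuclideanSpace ℝ (Fin (n + 1)))).real (ball 0 1) := by
  have h := (volume : Measure (EuclideanSpace ℝ (Fin (n + 1)))).toSphere_real_apply_univ
  simpa [omega_n, Measure.real] using h

theorem omega_n_pos (n : ℕ) : 0 < omega_n n := by
  rw [omega_n_eq]
  exact mul_pos (by positivity)
    (ENNReal.toReal_pos (measure_ball_pos _ _ one_pos).ne' measure_ball_lt_top.ne)

theorem integral_Ioi_pow_div_sqrt_pow (n : ℕ) :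
    ∫ r in Ioi (0 : ℝ), r ^ n * ((n + 1) / √(r ^ 2 + 1 ^ 2) ^ (n + 3)) = 1 := by
  have hlim : Tendsto (fun r : ℝ => (r / √(r ^ 2 + 1 ^ 2)) ^ (n + 1)) atTop (nhds 1) := by
    have h := (Real.continuous_sin.tendsto _).comp
      (Real.tendsto_arctan_atTop.mono_right nhdsWithin_le_nhds)
    rw [Real.sin_pi_div_two] at h
    have h2 := h.pow (n + 1)
    rw [one_pow] at h2
    refine h2.congr fun r => ?_
    simp [Real.sin_arctan, add_comm]
  have hder : ∀ r ∈ Ici (0 : ℝ), HasDerivAt (fun r : ℝ => (r / √(r ^ 2 + 1 ^ 2)) ^ (n + 1))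
      (r ^ n * ((n + 1) / √(r ^ 2 + 1 ^ 2) ^ (n + 3))) r := by
    intro r _
    have hs : 0 < √(r ^ 2 + 1 ^ 2) := Real.sqrt_pos.2 (by positivity)
    have hsq : √(r ^ 2 + 1 ^ 2) ^ 2 = r ^ 2 + 1 := by rw [Real.sq_sqrt (by positivity)]; ring
    have h1 : HasDerivAt (fun r : ℝ => r ^ 2 + 1 ^ 2) (2 * r) r := by
      simpa using ((hasDerivAt_id r).pow 2).add_const ((1 : ℝ) ^ 2)
    have h2 := h1.sqrt (by positivity)
    refine (((hasDerivAt_id r).div h2 hs.ne').pow (n + 1)).congr_deriv ?_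
    simp only [id, Pi.div_apply, Nat.add_sub_cancel, div_pow, pow_add, Nat.cast_add, Nat.cast_one]
    generalize √(r ^ 2 + 1 ^ 2) = s at *
    field_simp
    rw [hsq]
    ring
  simpa using integral_Ioi_of_hasDerivAt_of_nonneg' hder
    (fun r hr => by have : 0 < r := hr; positivity) hlim

/-- The kernel `(n + 1) (1 + ‖z‖²)^(-(n + 3) / 2)` has total mass `ω_n`. -/
theorem integral_one_div_regNorm_one_pow (n : ℕ) :
    ∫ z : EuclideanSpace ℝ (Fin (n + 1)), (n + 1) / regNorm 1 z ^ (n + 3) = omega_n n := by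
  have h := integral_fun_norm_addHaar (volume : Measure (EuclideanSpace ℝ (Fin (n + 1))))
    fun r : ℝ => (n + 1) / √(r ^ 2 + 1 ^ 2) ^ (n + 3)
  simp only [finrank_euclideanSpace, Fintype.card_fin, Nat.add_sub_cancel, smul_eq_mul,
    integral_Ioi_pow_div_sqrt_pow] at h
  rw [omega_n_eq]
  simpa [regNorm] using h

theorem integral_kernel_mul_eq {ε : ℝ} (hε : 0 < ε) (x : EuclideanSpace ℝ (Fin (n + 1)))
    (w : EuclideanSpace ℝ (Fin (n + 1)) → ℝ) :
    ∫ y, (n + 1) * ε ^ 2 / regNorm ε (x - y) ^ (n + 3) * w y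
      = ∫ u, (n + 1) / regNorm 1 u ^ (n + 3) * w (x - ε • u) := by
  have h1 := integral_sub_left_eq_self
    (fun z => (n + 1) * ε ^ 2 / regNorm ε z ^ (n + 3) * w (x - z)) volume x
  have h2 := Measure.integral_comp_smul_of_nonneg volume
    (fun z : EuclideanSpace ℝ (Fin (n + 1)) =>
      (n + 1) * ε ^ 2 / regNorm ε z ^ (n + 3) * w (x - z)) ε (hR := hε.le)
  simp only [sub_sub_cancel] at h1
  simp only [finrank_euclideanSpace, Fintype.card_fin, smul_eq_mul] at h2
  rw [h1, ← mul_right_inj' (inv_ne_zero (pow_pos hε (n + 1)).ne'), ← h2, ← integral_const_mul]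
  congr 1 with u
  have := regNorm_pos one_pos u
  rw [regNorm_smul hε.le, mul_pow]
  field_simp
  ring

theorem integrable_kernel (n : ℕ) :
    Integrable fun u : EuclideanSpace ℝ (Fin (n + 1)) => (n + 1) / regNorm 1 u ^ (n + 3) := by
  simpa [div_eq_mul_inv] using (integrable_one_div_regNorm_pow
    (ι := Fin (n + 1)) one_pos (m := n + 3) (by simp)).const_mul ((n : ℝ) + 1)

theorem integrable_kernel_sub_mul {ε C : ℝ} (hε : 0 < ε) (x : EuclideanSpace ℝ (Fin (n + 1)))
    {w : EuclideanSpace ℝ (Fin (n + 1)) → ℝ} (hw : Continuous w) (hC : ∀ y, |w y| ≤ C) :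
    Integrable fun y => (n + 1) * ε ^ 2 / regNorm ε (x - y) ^ (n + 3) * w y := by
  have h := ((integrable_one_div_regNorm_pow (ι := Fin (n + 1)) hε (m := n + 3)
    (by simp)).const_mul (((n : ℝ) + 1) * ε ^ 2)).comp_sub_left x
  simpa [div_eq_mul_inv] using h.mul_bdd hw.aestronglyMeasurable (.of_forall hC)

theorem tendsto_integral_kernel_mul {α : Type*} {l : Filter α} [l.IsCountablyGenerated]
    {w : EuclideanSpace ℝ (Fin (n + 1)) → ℝ} {C c : ℝ} {s : α → ℝ}
    {x : EuclideanSpace ℝ (Fin (n + 1))}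
    (hw : Continuous w) (hC : ∀ y, |w y| ≤ C)
    (hlim : ∀ᵐ u : EuclideanSpace ℝ (Fin (n + 1)),
      Tendsto (fun a => w (x - s a • u)) l (nhds c)) :
    Tendsto (fun a => ∫ u, (n + 1) / regNorm 1 u ^ (n + 3) * w (x - s a • u)) l
      (nhds (omega_n n * c)) := by
  rw [← integral_one_div_regNorm_one_pow, ← integral_mul_const]
  refine tendsto_integral_filter_of_dominated_convergence
    (fun u => (n + 1) / regNorm 1 u ^ (n + 3) * C) (.of_forall fun a => ?_)
    (.of_forall fun a => .of_forall fun u => ?_) ((integrable_kernel n).mul_const C) ?_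
  · exact (integrable_kernel n).aestronglyMeasurable.mul
      (hw.comp (by fun_prop)).aestronglyMeasurable
  · have h0 := regNorm_pos one_pos u
    rw [norm_mul, Real.norm_of_nonneg (by positivity), Real.norm_eq_abs]
    gcongr
    exact hC _
  · filter_upwards [hlim] with u hu using hu.const_mul _

theorem tendsto_radialJacobian_one_cobounded {ι : Type*} [Fintype ι] [DecidableEq ι] {δ : ℝ}
    (hδ : 0 < δ) (i j : ι) :
    Tendsto (radialJacobian 1 δ i j) (Bornology.cobounded _) (nhds 0) := by
  have h : Tendsto (fun y : EuclideanSpace ℝ ι => 2 / ‖y‖) (Bornology.cobounded _) (nhds 0) :=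
    tendsto_const_nhds.div_atTop tendsto_norm_cobounded_atTop
  refine squeeze_zero_norm' ?_ h
  filter_upwards [tendsto_norm_cobounded_atTop.eventually_gt_atTop 0] with y hy
  refine (abs_radialJacobian_le 1 hδ i j y).trans ?_
  have := norm_le_regNorm δ y
  norm_num
  gcongr

theorem integrable_one_div_norm_pow_mul_max_pow {c : ℝ} (hc : 0 < c) {p k : ℕ}
    (hn : n = p + k) : Integrable fun z : EuclideanSpace ℝ (Fin (n + 1)) =>
      1 / (‖z‖ ^ p * max ‖z‖ c ^ (k + 2)) := by
  rw [integrable_fun_norm_addHaar volume (f := fun r : ℝ => 1 / (r ^ p * max r c ^ (k + 2)))]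
  simp only [finrank_euclideanSpace, Fintype.card_fin, Nat.add_sub_cancel, smul_eq_mul]
  have h := ((integrable_inv_one_add_sq).const_mul (1 / c ^ 2 + 1)).integrableOn (s := Ioi 0)
  refine h.mono' (Measurable.aestronglyMeasurable (by fun_prop))
    ((ae_restrict_iff' measurableSet_Ioi).2 (.of_forall fun r hr => ?_))
  have hr : 0 < r := hr
  have hm : 0 < max r c := lt_max_of_lt_left hr
  have h1 : 1 + r ^ 2 ≤ (1 / c ^ 2 + 1) * max r c ^ 2 := by
    have h2 : r ^ 2 ≤ max r c ^ 2 := by gcongr; exact le_max_left _ _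
    have h3 : c ^ 2 ≤ max r c ^ 2 := by gcongr; exact le_max_right _ _
    have h4 : 1 ≤ 1 / c ^ 2 * max r c ^ 2 := by
      rw [one_div, ← div_eq_inv_mul, one_le_div (by positivity)]
      exact h3
    linarith
  rw [Real.norm_of_nonneg (by positivity)]
  calc r ^ n * (1 / (r ^ p * max r c ^ (k + 2))) = r ^ k / max r c ^ k * (1 / max r c ^ 2) := by
        rw [hn, pow_add, pow_add]
        field_simp
    _ ≤ 1 * (1 / max r c ^ 2) := by
        gcongr
        exact div_le_one_of_le₀ (by gcongr; exact le_max_left _ _) (by positivity)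
    _ ≤ (1 / c ^ 2 + 1) * (1 + r ^ 2)⁻¹ := by
        rw [one_mul, ← div_eq_mul_inv, div_le_div_iff₀ (by positivity) (by positivity)]
        linarith

theorem integrable_one_div_norm_sub_pow_mul_norm_sq (hn : 2 ≤ n)
    {x : EuclideanSpace ℝ (Fin (n + 1))} (hx : x ≠ 0) :
    Integrable fun y => 1 / (‖x - y‖ ^ n * ‖y‖ ^ 2) := by
  have hc : 0 < ‖x‖ / 2 := by positivity
  have h1 := integrable_one_div_norm_pow_mul_max_pow hc (p := 2) (k := n - 2)
    (show n = 2 + (n - 2) by omega)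
  have h2 := (integrable_one_div_norm_pow_mul_max_pow hc (p := n) (k := 0) rfl).comp_sub_left x
  rw [Nat.sub_add_cancel hn] at h1
  refine (h1.add h2).mono' (Measurable.aestronglyMeasurable (by fun_prop)) ?_
  filter_upwards [compl_mem_ae_iff.2 (measure_singleton (0 : EuclideanSpace ℝ (Fin (n + 1)))),
    compl_mem_ae_iff.2 (measure_singleton x)] with y hy0 hyx
  have hy : 0 < ‖y‖ := norm_pos_iff.2 hy0
  have hxy : 0 < ‖x - y‖ := norm_pos_iff.2 (sub_ne_zero.2 (Ne.symm hyx))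
  have htri : ‖x‖ ≤ ‖x - y‖ + ‖y‖ := by simpa using norm_add_le (x - y) y
  rw [Real.norm_of_nonneg (by positivity)]
  simp only [Pi.add_apply]
  rcases le_total ‖x - y‖ ‖y‖ with h | h
  · have hm : max ‖x - y‖ (‖x‖ / 2) ≤ ‖y‖ := max_le h (by linarith)
    refine le_add_of_nonneg_of_le (by positivity) ?_
    gcongr
  · have hm : max ‖y‖ (‖x‖ / 2) ≤ ‖x - y‖ := max_le h (by linarith)
    refine le_add_of_le_of_nonneg ?_ (by positivity)
    rw [mul_comm]
    gcongr

theorem abs_sum_regNormThird_le {δ : ℝ} (hδ : 0 < δ) (i : Fin (n + 1))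
    {y : EuclideanSpace ℝ (Fin (n + 1))} (hy : y ≠ 0) :
    |∑ k, regNormThird δ i k k y| ≤ 6 * (n + 1) / ‖y‖ ^ 2 := by
  have hy0 : 0 < ‖y‖ := norm_pos_iff.2 hy
  calc _ ≤ ∑ k, |regNormThird δ i k k y| := Finset.abs_sum_le_sum_abs _ _
    _ ≤ ∑ _k : Fin (n + 1), 6 / ‖y‖ ^ 2 := by
      refine Finset.sum_le_sum fun k _ => (abs_regNormThird_le hδ i k k y).trans ?_
      have := norm_le_regNorm δ y
      gcongr
    _ = _ := by
      simp
      ring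

theorem abs_apply_div_norm_pow_le {z : EuclideanSpace ℝ (Fin (n + 1))} (hz : z ≠ 0)
    (j : Fin (n + 1)) : |z j| / ‖z‖ ^ (n + 1) ≤ 1 / ‖z‖ ^ n := by
  have hz0 : 0 < ‖z‖ := norm_pos_iff.2 hz
  rw [div_le_div_iff₀ (by positivity) (by positivity), pow_succ, one_mul, mul_comm]
  gcongr
  exact PiLp.norm_apply_le z j

theorem tendsto_regNorm_nhdsGT {ι : Type*} [Fintype ι] (z : EuclideanSpace ℝ ι) :
    Tendsto (fun ε => regNorm ε z) (nhdsWithin 0 (Ioi 0)) (nhds ‖z‖) := by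
  have h := (continuous_regNorm_left z).tendsto 0
  rw [regNorm_zero] at h
  exact h.mono_left nhdsWithin_le_nhds

/-- The representation of `∂_i ∂_j` of `regNorm δ` as a singular convolution of its Laplacian. -/
theorem integral_kernel_mul_sum_regNormThird (hn : 2 ≤ n) {δ : ℝ} (hδ : 0 < δ)
    {x : EuclideanSpace ℝ (Fin (n + 1))} (hx : x ≠ 0) (i j : Fin (n + 1)) :
    ∫ y, (x j - y j) / ‖x - y‖ ^ (n + 1) * ∑ k, regNormThird δ i k k y
      = omega_n n * radialJacobian 1 δ i j x := by
  have hcont := continuous_radialJacobian 1 hδ i j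
  have hbdd : ∀ y, |radialJacobian 1 δ i j y| ≤ 2 / δ := fun y =>
    (abs_radialJacobian_le 1 hδ i j y).trans (by
      have := le_regNorm δ y
      norm_num
      gcongr)
  have hsmall : ∀ᶠ ε : ℝ in nhdsWithin 0 (Ioi 0), 0 < ε ∧ ε ≤ ε⁻¹ := by
    filter_upwards [Ioc_mem_nhdsGT (zero_lt_one' ℝ)] with ε hε
    exact ⟨hε.1, hε.2.trans ((one_le_inv₀ hε.1).2 hε.2)⟩
  have hL : Tendsto (fun ε : ℝ => ∫ y, ((x j - y j) / regNorm ε (x - y) ^ (n + 1)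
        - (x j - y j) / regNorm ε⁻¹ (x - y) ^ (n + 1)) * ∑ k, regNormThird δ i k k y)
      (nhdsWithin 0 (Ioi 0))
      (nhds (∫ y, (x j - y j) / ‖x - y‖ ^ (n + 1) * ∑ k, regNormThird δ i k k y)) := by
    refine tendsto_integral_filter_of_dominated_convergence
      (fun y => 6 * (n + 1) * (1 / (‖x - y‖ ^ n * ‖y‖ ^ 2))) ?_ ?_
      ((integrable_one_div_norm_sub_pow_mul_norm_sq hn hx).const_mul _) ?_
    · filter_upwards [hsmall] with ε hε
      have hf : Continuous fun y : EuclideanSpace ℝ (Fin (n + 1)) => x j - y j := by fun_prop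
      refine Continuous.aestronglyMeasurable (.mul (.sub ?_ ?_)
        (continuous_finsetSum _ fun k _ => continuous_regNormThird hδ i k k))
      · exact hf.div (by fun_prop) fun y => (pow_pos (regNorm_pos hε.1 _) _).ne'
      · exact hf.div (by fun_prop) fun y => (pow_pos (regNorm_pos (inv_pos.2 hε.1) _) _).ne'
    · filter_upwards [hsmall] with ε hε
      filter_upwards [compl_mem_ae_iff.2 (measure_singleton (0 : EuclideanSpace ℝ (Fin (n + 1)))),
        compl_mem_ae_iff.2 (measure_singleton x)] with y hy0 hyx
      have hyx' : x - y ≠ 0 := sub_ne_zero.2 (Ne.symm hyx)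
      have hxy : 0 < ‖x - y‖ := norm_pos_iff.2 hyx'
      have hy : 0 < ‖y‖ := norm_pos_iff.2 hy0
      have h1 := one_div_regNorm_pow_sub_nonneg hε.1 hε.2 (n + 1) (x - y)
      have h2 : 1 / regNorm ε (x - y) ^ (n + 1) - 1 / regNorm ε⁻¹ (x - y) ^ (n + 1)
          ≤ 1 / ‖x - y‖ ^ (n + 1) := by
        have h3 := norm_le_regNorm ε (x - y)
        have h4 := regNorm_pos (inv_pos.2 hε.1) (x - y)
        have h5 : 1 / regNorm ε (x - y) ^ (n + 1) ≤ 1 / ‖x - y‖ ^ (n + 1) := by gcongr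
        have h6 : 0 ≤ 1 / regNorm ε⁻¹ (x - y) ^ (n + 1) := by positivity
        linarith
      have h7 := abs_apply_div_norm_pow_le hyx' j
      rw [norm_mul, show (x j - y j) / regNorm ε (x - y) ^ (n + 1)
          - (x j - y j) / regNorm ε⁻¹ (x - y) ^ (n + 1) = (x - y) j *
            (1 / regNorm ε (x - y) ^ (n + 1) - 1 / regNorm ε⁻¹ (x - y) ^ (n + 1)) by
          simp only [PiLp.sub_apply]; ring, norm_mul, Real.norm_of_nonneg h1, Real.norm_eq_abs,
        Real.norm_eq_abs]
      calc _ ≤ |(x - y) j| * (1 / ‖x - y‖ ^ (n + 1)) * (6 * (n + 1) / ‖y‖ ^ 2) := by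
            gcongr
            exact abs_sum_regNormThird_le hδ i hy0
        _ ≤ 1 / ‖x - y‖ ^ n * (6 * (n + 1) / ‖y‖ ^ 2) := by
            gcongr
            rwa [mul_one_div]
        _ = _ := by field_simp
    · filter_upwards [compl_mem_ae_iff.2 (measure_singleton x)] with y hyx
      have hxy : 0 < ‖x - y‖ := norm_pos_iff.2 (sub_ne_zero.2 (Ne.symm hyx))
      have h1 := (tendsto_const_nhds (x := x j - y j)).div
        ((tendsto_regNorm_nhdsGT (x - y)).pow (n + 1)) (pow_pos hxy _).ne'
      have h2 : Tendsto (fun ε : ℝ => regNorm ε⁻¹ (x - y)) (nhdsWithin 0 (Ioi 0)) atTop :=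
        tendsto_atTop_mono (fun ε => le_regNorm ε⁻¹ (x - y)) tendsto_inv_nhdsGT_zero
      have h3 := (tendsto_const_nhds (x := x j - y j)).div_atTop
        ((tendsto_pow_atTop n.succ_ne_zero).comp h2)
      simpa using (h1.sub h3).mul_const (∑ k, regNormThird δ i k k y)
  have hQ0 : Tendsto (fun ε : ℝ => ∫ u, (n + 1) / regNorm 1 u ^ (n + 3)
        * radialJacobian 1 δ i j (x - ε • u)) (nhdsWithin 0 (Ioi 0))
      (nhds (omega_n n * radialJacobian 1 δ i j x)) := by
    refine tendsto_integral_kernel_mul hcont hbdd (.of_forall fun u => ?_)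
    have h : Continuous fun ε : ℝ => radialJacobian 1 δ i j (x - ε • u) :=
      hcont.comp (by fun_prop)
    simpa using (h.tendsto 0).mono_left nhdsWithin_le_nhds
  have hQ1 : Tendsto (fun ε : ℝ => ∫ u, (n + 1) / regNorm 1 u ^ (n + 3)
        * radialJacobian 1 δ i j (x - ε⁻¹ • u)) (nhdsWithin 0 (Ioi 0))
      (nhds (omega_n n * 0)) := by
    refine tendsto_integral_kernel_mul hcont hbdd ?_
    filter_upwards [compl_mem_ae_iff.2 (measure_singleton (0 : EuclideanSpace ℝ (Fin (n + 1))))]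
      with u hu
    have hu0 : 0 < ‖u‖ := norm_pos_iff.2 hu
    refine (tendsto_radialJacobian_one_cobounded hδ i j).comp ?_
    rw [← tendsto_norm_atTop_iff_cobounded]
    have h : Tendsto (fun ε : ℝ => ε⁻¹ * ‖u‖ - ‖x‖) (nhdsWithin 0 (Ioi 0)) atTop :=
      tendsto_atTop_add_const_right _ _ (tendsto_inv_nhdsGT_zero.atTop_mul_const hu0)
    refine tendsto_atTop_mono (fun ε => ?_) h
    have h1 := norm_sub_norm_le (ε⁻¹ • u) x
    rw [norm_smul, norm_sub_rev, Real.norm_eq_abs] at h1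
    have h2 := mul_le_mul_of_nonneg_right (le_abs_self ε⁻¹) hu0.le
    linarith
  have hQ := hQ0.sub hQ1
  rw [mul_zero, sub_zero] at hQ
  refine tendsto_nhds_unique hL (hQ.congr' ?_)
  filter_upwards [hsmall] with ε hε
  have hε' := inv_pos.2 hε.1
  have hg := integral_regularized_green hε.1 hε.2 hδ (Fintype.card_fin (n + 1)) x i j
  rw [hg, ← integral_kernel_mul_eq hε.1, ← integral_kernel_mul_eq hε', ← integral_sub
    (integrable_kernel_sub_mul hε.1 x hcont hbdd) (integrable_kernel_sub_mul hε' x hcont hbdd)]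
  congr 1 with y
  push_cast
  ring

/-- The second derivatives `∂_i ∂_j ‖x‖` as a singular convolution of `∂_i Δ‖y‖ = -n y_i / ‖y‖³`. -/
theorem integral_kernel_mul_gradient (hn : 2 ≤ n) {x : EuclideanSpace ℝ (Fin (n + 1))}
    (hx : x ≠ 0) (i j : Fin (n + 1)) :
    Integrable (fun y => (x j - y j) / ‖x - y‖ ^ (n + 1) * -(n * y i / ‖y‖ ^ 3)) ∧
    ∫ y, (x j - y j) / ‖x - y‖ ^ (n + 1) * -(n * y i / ‖y‖ ^ 3)
      = omega_n n * ((if i = j then 1 else 0) / ‖x‖ - x i * x j / ‖x‖ ^ 3) := by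
  have hx0 : 0 < ‖x‖ := norm_pos_iff.2 hx
  have hdom : Integrable fun y : EuclideanSpace ℝ (Fin (n + 1)) =>
      6 * (n + 1) * (1 / (‖x - y‖ ^ n * ‖y‖ ^ 2)) :=
    (integrable_one_div_norm_sub_pow_mul_norm_sq hn hx).const_mul _
  have hptw : ∀ᵐ y, Tendsto (fun δ => (x j - y j) / ‖x - y‖ ^ (n + 1)
      * ∑ k, regNormThird δ i k k y) (nhdsWithin 0 (Ioi 0))
      (nhds ((x j - y j) / ‖x - y‖ ^ (n + 1) * -(n * y i / ‖y‖ ^ 3))) := by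
    filter_upwards [compl_mem_ae_iff.2 (measure_singleton (0 : EuclideanSpace ℝ (Fin (n + 1))))]
      with y hy0
    have hy : 0 < ‖y‖ := norm_pos_iff.2 hy0
    refine Tendsto.const_mul _ ?_
    have hρ := tendsto_regNorm_nhdsGT y
    have hδ : Tendsto (fun δ : ℝ => δ) (nhdsWithin 0 (Ioi 0)) (nhds 0) := nhdsWithin_le_nhds
    have h1 := ((tendsto_const_nhds (x := n * y i)).div (hρ.pow 3) (pow_pos hy 3).ne').neg
    have h2 := (((hδ.pow 2).const_mul 3).mul_const (y i)).div (hρ.pow 5) (pow_pos hy 5).ne'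
    have h3 := h1.sub h2
    simp only [ne_eq, OfNat.ofNat_ne_zero, not_false_eq_true, zero_pow, mul_zero, zero_mul,
      zero_div, sub_zero] at h3
    refine h3.congr' ?_
    filter_upwards [self_mem_nhdsWithin] with δ hδ0
    rw [sum_regNormThird hδ0]
    simp
  have hbound : ∀ δ : ℝ, 0 < δ → ∀ᵐ y, ‖(x j - y j) / ‖x - y‖ ^ (n + 1)
      * ∑ k, regNormThird δ i k k y‖ ≤ 6 * (n + 1) * (1 / (‖x - y‖ ^ n * ‖y‖ ^ 2)) := by
    intro δ hδ
    filter_upwards [compl_mem_ae_iff.2 (measure_singleton (0 : EuclideanSpace ℝ (Fin (n + 1)))),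
      compl_mem_ae_iff.2 (measure_singleton x)] with y hy0 hyx
    have h := abs_apply_div_norm_pow_le (sub_ne_zero.2 (Ne.symm hyx)) j
    rw [norm_mul, norm_div, Real.norm_eq_abs, Real.norm_eq_abs (∑ k, _), norm_pow, norm_norm]
    calc _ ≤ 1 / ‖x - y‖ ^ n * (6 * (n + 1) / ‖y‖ ^ 2) :=
          mul_le_mul h (abs_sum_regNormThird_le hδ i hy0) (abs_nonneg _) (by positivity)
      _ = _ := by field_simp
  have hL := tendsto_integral_filter_of_dominated_convergence (l := nhdsWithin (0 : ℝ) (Ioi 0))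
    (F := fun δ y => (x j - y j) / ‖x - y‖ ^ (n + 1) * ∑ k, regNormThird δ i k k y) _
    (by
      filter_upwards [self_mem_nhdsWithin] with δ hδ
      exact (Measurable.aestronglyMeasurable (by fun_prop)).mul
        (continuous_finsetSum _ fun k _ => continuous_regNormThird hδ i k k).aestronglyMeasurable)
    (by filter_upwards [self_mem_nhdsWithin] with δ hδ using hbound δ hδ) hdom hptw
  have hR : Tendsto (fun δ => omega_n n * radialJacobian 1 δ i j x) (nhdsWithin 0 (Ioi 0))
      (nhds (omega_n n * ((if i = j then 1 else 0) / ‖x‖ - x i * x j / ‖x‖ ^ 3))) := by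
    refine Tendsto.const_mul _ ?_
    have hρ := tendsto_regNorm_nhdsGT x
    have h := ((tendsto_const_nhds (x := if i = j then (1 : ℝ) else 0)).div hρ hx0.ne').sub
      ((tendsto_const_nhds (x := x i * x j)).div (hρ.pow 3) (pow_pos hx0 3).ne')
    simpa [radialJacobian] using h
  refine ⟨hdom.mono' (Measurable.aestronglyMeasurable (by fun_prop)) ?_,
    tendsto_nhds_unique hL (hR.congr' ?_)⟩
  · have hseq : Tendsto (fun m : ℕ => 1 / ((m : ℝ) + 1)) atTop (nhdsWithin 0 (Ioi 0)) :=
      tendsto_nhdsWithin_iff.2 ⟨tendsto_one_div_add_atTop_nhds_zero_nat,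
        .of_forall fun m => mem_Ioi.2 Nat.one_div_pos_of_nat⟩
    filter_upwards [hptw, ae_all_iff.2 fun m : ℕ =>
      hbound (1 / ((m : ℝ) + 1)) Nat.one_div_pos_of_nat] with y hy hb
    exact le_of_tendsto (hy.comp hseq).norm (.of_forall hb)
  · filter_upwards [self_mem_nhdsWithin] with δ hδ
    exact (integral_kernel_mul_sum_regNormThird hn hδ hx i j).symm

end Limits

/-- the limit `lim_{R→∞} ∫_{B_R} F_{x_j}(x,y) ∂_{y_i}(|y|⁻¹) dy
equals `(1/n)(δ_{ij}/|x| - x_i x_j/|x|³)`. -/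
theorem stmt_18 (n : ℕ) (hn : 2 ≤ n)
    (x : EuclideanSpace ℝ (Fin (n + 1))) (hx : x ≠ 0) (i j : Fin (n + 1)) :
    Tendsto (fun R : ℝ =>
        ∫ y in Metric.ball (0 : EuclideanSpace ℝ (Fin (n + 1))) R,
          (x j - y j) / (omega_n n * ‖x - y‖ ^ (n + 1)) * (-(y i) / ‖y‖ ^ 3))
      atTop
      (nhds ((1 / n) * ((if i = j then (1 : ℝ) else 0) / ‖x‖ - x i * x j / ‖x‖ ^ 3))) := by
  obtain ⟨hint, heq⟩ := integral_kernel_mul_gradient hn hx i j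
  have hω := (omega_n_pos n).ne'
  have hn0 : (n : ℝ) ≠ 0 := by positivity
  have e : (fun y : EuclideanSpace ℝ (Fin (n + 1)) =>
      (x j - y j) / (omega_n n * ‖x - y‖ ^ (n + 1)) * (-(y i) / ‖y‖ ^ 3))
      = fun y => 1 / (omega_n n * n)
        * ((x j - y j) / ‖x - y‖ ^ (n + 1) * -(n * y i / ‖y‖ ^ 3)) := by
    ext y
    rw [mul_div_assoc (n : ℝ), div_mul_eq_div_div_swap]
    field_simp
  have h := (aecover_ball (μ := volume) (x := (0 : EuclideanSpace ℝ (Fin (n + 1))))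
    tendsto_id).integral_tendsto_of_countably_generated (hint.const_mul (1 / (omega_n n * n)))
  rw [integral_const_mul, heq] at h
  rw [e]
  have hlim : ∀ L : ℝ, 1 / (omega_n n * n) * (omega_n n * L) = 1 / n * L := fun L => by
    field_simp
  rw [hlim] at h
  exact h
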